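/- Let δ ∈ (0, 1/2) and C_b > 5. Assume that Σ \ ∂Σ is nonempty, that R(x, δ) > 0 for every x ∈ Σ \ ∂Σ, that a_δ is finite, and that the following scale-expansion property holds: for every y ∈ Σ \ ∂Σ and every R > 0 such that B̄_Σ(y, C_b·R) ⊆ Σ \ ∂Σ and such that every intrinsic closed ball B̄_Σ(z, R) with B̄_Σ(z, R) ⊆ B̄_Σ(y, C_b·R) is δ weakly chord arc, the ball B̄_Σ(y, 5R) is δ weakly chord arc. Then a_δ ≤ C_b. -/

import Mathlib

open Metric Set

/-- `Σ(x, r)`: the closure (in the intrinsic topology of `X`) of the connected component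
containing `x` of the intersection of `Σ` with the open Euclidean ball `𝔹(ι x, r)`,
where `ι : X → ℝ³` realizes the surface `Σ` as a subset of `ℝ³`. -/
noncomputable def sigmaComp {X : Type*} [TopologicalSpace X]
    (ι : X → EuclideanSpace ℝ (Fin 3)) (x : X) (r : ℝ) : Set X :=
  closure (connectedComponentIn (ι ⁻¹' Metric.ball (ι x) r) x)

/-- A set is homeomorphic to a closed 2-dimensional disk. -/
def IsDisk2 {X : Type*} [TopologicalSpace X] (A : Set X) : Prop :=
  Nonempty (↥A ≃ₜ ↥(Metric.closedBall (0 : EuclideanSpace ℝ (Fin 2)) 1))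

/-- The intrinsic closed ball `B̄_Σ(x, R)` is `δ` weakly chord arc:
(i) for all `s ∈ (0, R)`, `B̄_Σ(x, s) ⊆ Σ \ ∂Σ`, and
(ii) for all `s ∈ (0, R]`, `Σ(x, δ s)` is homeomorphic to a closed 2-disk and
`Σ(x, δ s) ⊆ B̄_Σ(x, s/2)`. -/
def WeaklyChordArc {X : Type*} [MetricSpace X]
    (ι : X → EuclideanSpace ℝ (Fin 3)) (bd : Set X) (δ : ℝ) (x : X) (R : ℝ) : Prop :=
  (∀ s ∈ Set.Ioo (0 : ℝ) R, Metric.closedBall x s ⊆ bdᶜ) ∧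
  ∀ s ∈ Set.Ioc (0 : ℝ) R,
    IsDisk2 (sigmaComp ι x (δ * s)) ∧ sigmaComp ι x (δ * s) ⊆ Metric.closedBall x (s / 2)

/-- `R(x, δ)`: the supremum of radii `R < d_Σ(x, ∂Σ)` such that `B̄_Σ(x, R)` is `δ` weakly
chord arc (equal to `0` if there is no such `R`, by the convention `sSup ∅ = 0` in `ℝ`). -/
noncomputable def chordArcRadius {X : Type*} [MetricSpace X]
    (ι : X → EuclideanSpace ℝ (Fin 3)) (bd : Set X) (x : X) (δ : ℝ) : ℝ :=
  sSup {R : ℝ | R < Metric.infDist x bd ∧ WeaklyChordArc ι bd δ x R}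

/-- The set of ratios `d_Σ(x, ∂Σ) / R(x, δ)` for `x ∈ Σ \ ∂Σ`; `a_δ` is its supremum. -/
noncomputable def ratioSet {X : Type*} [MetricSpace X]
    (ι : X → EuclideanSpace ℝ (Fin 3)) (bd : Set X) (δ : ℝ) : Set ℝ :=
  {r : ℝ | ∃ x ∉ bd, r = Metric.infDist x bd / chordArcRadius ι bd x δ}

/-- A weakly chord arc ball remains weakly chord arc when its radius shrinks. -/
theorem WeaklyChordArc.mono {X : Type*} [MetricSpace X]
    {ι : X → EuclideanSpace ℝ (Fin 3)} {bd : Set X} {δ : ℝ} {x : X} {R R' : ℝ}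
    (h : WeaklyChordArc ι bd δ x R') (hR : R ≤ R') : WeaklyChordArc ι bd δ x R :=
  ⟨fun s hs => h.1 s ⟨hs.1, hs.2.trans_le hR⟩, fun s hs => h.2 s ⟨hs.1, hs.2.trans hR⟩⟩

/-- Every ball of radius less than `R(x, δ)` is weakly chord arc. -/
theorem weaklyChordArc_of_lt_chordArcRadius {X : Type*} [MetricSpace X]
    {ι : X → EuclideanSpace ℝ (Fin 3)} {bd : Set X} {δ : ℝ} {x : X} {R : ℝ}
    (hpos : 0 < chordArcRadius ι bd x δ) (hR : R < chordArcRadius ι bd x δ) :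
    WeaklyChordArc ι bd δ x R := by
  have hS : {R : ℝ | R < Metric.infDist x bd ∧ WeaklyChordArc ι bd δ x R}.Nonempty := by
    by_contra h
    rw [chordArcRadius, Set.not_nonempty_iff_eq_empty.mp h, Real.sSup_empty] at hpos
    exact hpos.false
  obtain ⟨R', hR', hlt⟩ := exists_lt_of_lt_csSup hS hR
  exact hR'.2.mono hlt.le

/-- A weakly chord arc radius below the distance to the boundary is at most `R(x, δ)`. -/
theorem WeaklyChordArc.le_chordArcRadius {X : Type*} [MetricSpace X]
    {ι : X → EuclideanSpace ℝ (Fin 3)} {bd : Set X} {δ : ℝ} {x : X} {R : ℝ}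
    (h : WeaklyChordArc ι bd δ x R) (hR : R < Metric.infDist x bd) :
    R ≤ chordArcRadius ι bd x δ :=
  le_csSup ⟨Metric.infDist x bd, fun _ ht => ht.1.le⟩ ⟨hR, h⟩

/-- for `δ ∈ (0, 1/2)` and `C_b > 5`, if `Σ \ ∂Σ ≠ ∅`, `R(x, δ) > 0` on
`Σ \ ∂Σ`, `a_δ` is finite, and the scale-expansion property holds (whenever
`B̄_Σ(y, C_b R) ⊆ Σ \ ∂Σ` and every subball `B̄_Σ(z, R) ⊆ B̄_Σ(y, C_b R)` is `δ` weakly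
chord arc, the ball `B̄_Σ(y, 5R)` is `δ` weakly chord arc), then `a_δ ≤ C_b`. -/
theorem ratio_le_of_scale_expansion
    {X : Type*} [MetricSpace X] [CompactSpace X] [ConnectedSpace X]
    (ι : X → EuclideanSpace ℝ (Fin 3)) (hι : Continuous ι) (hinj : Function.Injective ι)
    (bd : Set X) (hbd_closed : IsClosed bd) (hbd_ne : bd.Nonempty)
    (δ C_b : ℝ) (hδ : δ ∈ Set.Ioo (0 : ℝ) (1 / 2)) (hCb : 5 < C_b)
    (hne : ∃ x, x ∉ bd)
    (hRpos : ∀ x ∉ bd, 0 < chordArcRadius ι bd x δ)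
    (hbdd : BddAbove (ratioSet ι bd δ))
    (hexp : ∀ y ∉ bd, ∀ R > (0 : ℝ), Metric.closedBall y (C_b * R) ⊆ bdᶜ →
      (∀ z : X, Metric.closedBall z R ⊆ Metric.closedBall y (C_b * R) →
        WeaklyChordArc ι bd δ z R) →
      WeaklyChordArc ι bd δ y (5 * R)) :
    sSup (ratioSet ι bd δ) ≤ C_b := by
  by_contra! hlt
  set a := sSup (ratioSet ι bd δ)
  have hratio : (ratioSet ι bd δ).Nonempty := let ⟨x, hx⟩ := hne; ⟨_, x, hx, rfl⟩
  obtain ⟨_, ⟨y, hy, rfl⟩, hya⟩ :=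
    exists_lt_of_lt_csSup hratio (show (a + C_b) / 2 < a by linarith)
  have hr := hRpos y hy
  set r := chordArcRadius ι bd y δ with hr_def
  rw [lt_div_iff₀ hr] at hya
  have har : C_b * r < a * r := mul_lt_mul_of_pos_right hlt hr
  have hCr : 5 * r < C_b * r := mul_lt_mul_of_pos_right hCb hr
  have hball : Metric.closedBall y (C_b * (r / 4)) ⊆ bdᶜ := fun z hz hzbd => by
    have hzy := Metric.infDist_le_dist_of_mem (x := y) hzbd
    rw [Metric.mem_closedBall'] at hz
    linarith
  have hwca : WeaklyChordArc ι bd δ y (5 * (r / 4)) := by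
    refine hexp y hy (r / 4) (by positivity) hball fun z hz => ?_
    have hzy : z ∈ Metric.closedBall y (C_b * (r / 4)) :=
      hz (Metric.mem_closedBall_self (by positivity))
    have hzbd : z ∉ bd := hball hzy
    have hpos := hRpos z hzbd
    refine weaklyChordArc_of_lt_chordArcRadius hpos ?_
    have hza : Metric.infDist z bd ≤ a * chordArcRadius ι bd z δ := by
      rw [← div_le_iff₀ hpos]
      exact le_csSup hbdd ⟨z, hzbd, rfl⟩
    have hdist : Metric.infDist y bd ≤ Metric.infDist z bd + dist y z :=
      Metric.infDist_le_infDist_add_dist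
    rw [Metric.mem_closedBall'] at hzy
    have : a * (r / 4) < a * chordArcRadius ι bd z δ := by linarith
    exact lt_of_mul_lt_mul_left this (by linarith)
  have hle := hwca.le_chordArcRadius (by linarith)
  rw [← hr_def] at hle
  linarith
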